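/- arXiv:1703.08370 — 6 statements merged into one kernel-verified Lean document; each statement's English description precedes it below -/
import Mathlib

section
/- Let f : X → ℝ be differentiable with block-i Lipschitz continuous gradient with constant L_i > 0, let g_1, …, g_N : E_j → ℝ be convex, and let Q_i be a self-adjoint linear map on E_i satisfying ⟪Q_i s, s⟫ ≥ L_i ‖s‖² for all s ∈ E_i. Then for every x ∈ X and every s ∈ E_i, V(x +_i s) ≤ f(x) + q_i(s; x) + Σ_{j ≠ i} g_j(x_j). -/
open scoped RealInnerProductSpace

/-- The block gradient `∇_i f(x) ∈ E i`: the gradient at `x i` of the map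
`t ↦ f (x with i-th block replaced by t)`. -/
noncomputable def blockGrad {N : ℕ} {E : Fin N → Type*} [∀ i, NormedAddCommGroup (E i)]
    [∀ i, InnerProductSpace ℝ (E i)] [∀ i, FiniteDimensional ℝ (E i)]
    (f : (∀ i, E i) → ℝ) (i : Fin N) (x : ∀ i, E i) : E i :=
  gradient (fun t => f (Function.update x i t)) (x i)

/-- The local quadratic approximation
`q_i(s; x) := ⟪∇_i f(x), s⟫ + (1/2)⟪Q s, s⟫ + g (x_i + s)`. -/
noncomputable def qApprox {N : ℕ} {E : Fin N → Type*} [∀ i, NormedAddCommGroup (E i)]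
    [∀ i, InnerProductSpace ℝ (E i)] [∀ i, FiniteDimensional ℝ (E i)]
    (f : (∀ i, E i) → ℝ) (i : Fin N) (g : E i → ℝ) (Q : E i →ₗ[ℝ] E i)
    (x : ∀ i, E i) (s : E i) : ℝ :=
  ⟪blockGrad f i x, s⟫ + (1 / 2) * ⟪Q s, s⟫ + g (x i + s)

/-- **Descent lemma**: a quadratic upper bound along `s` from a Lipschitz-type bound on the gradient
at the base point `y`. -/
theorem le_add_inner_gradient_add_sq {F : Type*} [NormedAddCommGroup F] [InnerProductSpace ℝ F]
    [CompleteSpace F] {h : F → ℝ} (hh : Differentiable ℝ h) {L : ℝ} {y : F}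
    (hlip : ∀ s, ‖gradient h (y + s) - gradient h y‖ ≤ L * ‖s‖) (s : F) :
    h (y + s) ≤ h y + ⟪gradient h y, s⟫ + L / 2 * ‖s‖ ^ 2 := by
  have hline (t : ℝ) :
      HasDerivAt (fun t : ℝ => h (y + t • s)) ⟪gradient h (y + t • s), s⟫ t := by
    have hs : HasDerivAt (fun t : ℝ => y + t • s) s t := by
      simpa using ((hasDerivAt_id t).smul_const s).const_add y
    simpa [Function.comp_def] using
      (hh (y + t • s)).hasGradientAt.hasFDerivAt.comp_hasDerivAt t hs
  have hB (t : ℝ) : HasDerivAt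
      (fun t : ℝ => h y + t * ⟪gradient h y, s⟫ + L / 2 * ‖s‖ ^ 2 * t ^ 2)
      (⟪gradient h y, s⟫ + L * ‖s‖ ^ 2 * t) t := by
    refine ((((hasDerivAt_id t).mul_const ⟪gradient h y, s⟫).const_add (h y)).add
      ((hasDerivAt_pow 2 t).const_mul (L / 2 * ‖s‖ ^ 2))).congr_deriv ?_
    push_cast
    ring
  have key := image_le_of_deriv_right_le_deriv_boundary (a := 0) (b := 1)
    (fun t _ => (hline t).continuousAt.continuousWithinAt)
    (fun t _ => (hline t).hasDerivWithinAt) (by simp)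
    (fun t _ => (hB t).continuousAt.continuousWithinAt)
    (fun t _ => (hB t).hasDerivWithinAt) (fun t ht => ?_)
    (Set.right_mem_Icc.2 zero_le_one)
  · simpa using key
  · have hdiff := hlip (t • s)
    rw [norm_smul, Real.norm_of_nonneg ht.1] at hdiff
    have hcs := real_inner_le_norm (gradient h (y + t • s) - gradient h y) s
    rw [inner_sub_left] at hcs
    have := mul_le_mul_of_nonneg_right hdiff (norm_nonneg s)
    linarith

/-- `V(x +_i s) ≤ f(x) + q_i(s; x) + Σ_{j ≠ i} g_j(x_j)`. -/
theorem stmt2 {N : ℕ} (hN : 1 ≤ N) {E : Fin N → Type*} [∀ i, NormedAddCommGroup (E i)]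
    [∀ i, InnerProductSpace ℝ (E i)] [∀ i, FiniteDimensional ℝ (E i)]
    (f : (∀ i, E i) → ℝ) (hf : Differentiable ℝ f) (i : Fin N) (Li : ℝ) (hLi : 0 < Li)
    (hlip : ∀ (x : ∀ i, E i) (s : E i),
      ‖blockGrad f i (Function.update x i (x i + s)) - blockGrad f i x‖ ≤ Li * ‖s‖)
    (g : ∀ j, E j → ℝ) (hg : ∀ j, ConvexOn ℝ Set.univ (g j))
    (Q : E i →ₗ[ℝ] E i) (hQsym : Q.IsSymmetric)
    (hQ : ∀ s : E i, Li * ‖s‖ ^ 2 ≤ ⟪Q s, s⟫) :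
    ∀ (x : ∀ i, E i) (s : E i),
      (f (Function.update x i (x i + s)) + ∑ j, g j (Function.update x i (x i + s) j)) ≤
        f x + qApprox f i (g i) Q x s + ∑ j ∈ Finset.univ.erase i, g j (x j) := by
  intro x s
  have hdiff : Differentiable ℝ fun t => f (Function.update x i t) := fun t =>
    (hf _).comp t (hasFDerivAt_update x t).differentiableAt
  have hdescent := le_add_inner_gradient_add_sq hdiff (L := Li) (y := x i)
    (fun s => by simpa [blockGrad] using hlip x s) s
  have hsum : ∑ j, g j (Function.update x i (x i + s) j) =
      g i (x i + s) + ∑ j ∈ Finset.univ.erase i, g j (x j) := by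
    rw [← Finset.add_sum_erase _ _ (Finset.mem_univ i), Function.update_self]
    congr 1
    refine Finset.sum_congr rfl fun j hj => ?_
    rw [Function.update_of_ne (Finset.ne_of_mem_erase hj)]
  rw [Function.update_eq_self] at hdescent
  rw [hsum, qApprox, blockGrad]
  linarith [hQ s]
end

section
/- Let f : X → ℝ be differentiable with block-i Lipschitz continuous gradient with constant L_i > 0, let g_1, …, g_N be convex real-valued functions on the respective blocks, and let Q_i be a self-adjoint linear map on E_i satisfying ⟪Q_i s, s⟫ ≥ L_i ‖s‖² for all s ∈ E_i. If x ∈ X and d_i ∈ E_i minimizes s ↦ q_i(s; x) over E_i, then V(x +_i d_i) ≤ V(x) − (1/2)⟪Q_i d_i, d_i⟫. -/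
open scoped RealInnerProductSpace

/-- The descent lemma: if the gradient of `h` is `L`-Lipschitz relative to the point `y`, then `h` is
bounded above by its quadratic model at `y`. -/
theorem descent_lemma {F : Type*} [NormedAddCommGroup F] [InnerProductSpace ℝ F] [CompleteSpace F]
    {h : F → ℝ} (hh : Differentiable ℝ h) {L : ℝ} {y : F}
    (hlip : ∀ s, ‖gradient h (y + s) - gradient h y‖ ≤ L * ‖s‖) (d : F) :
    h (y + d) ≤ h y + ⟪gradient h y, d⟫ + L / 2 * ‖d‖ ^ 2 := by
  let φ : ℝ → ℝ := fun t => h (y + t • d) - t * ⟪gradient h y, d⟫ - L / 2 * ‖d‖ ^ 2 * t ^ 2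
  have hφ (t : ℝ) : HasDerivAt φ
      (⟪gradient h (y + t • d), d⟫ - ⟪gradient h y, d⟫ - L * ‖d‖ ^ 2 * t) t := by
    have hline : HasDerivAt (fun t : ℝ => y + t • d) d t := by
      simpa using ((hasDerivAt_id t).smul_const d).const_add y
    have hcomp : HasDerivAt (fun t : ℝ => h (y + t • d)) ⟪gradient h (y + t • d), d⟫ t := by
      have hcomp' := (hh (y + t • d)).hasGradientAt.hasFDerivAt.comp_hasDerivAt t hline
      rw [InnerProductSpace.toDual_apply_apply] at hcomp'
      exact hcomp'
    have hquad := (hasDerivAt_pow 2 t).const_mul (L / 2 * ‖d‖ ^ 2)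
    refine ((hcomp.sub ((hasDerivAt_id t).mul_const ⟪gradient h y, d⟫)).sub hquad).congr_deriv ?_
    push_cast
    ring
  have hanti : AntitoneOn φ (Set.Icc 0 1) := by
    refine antitoneOn_of_deriv_nonpos (convex_Icc 0 1)
      (fun t _ => (hφ t).continuousAt.continuousWithinAt)
      (fun t _ => (hφ t).differentiableAt.differentiableWithinAt) fun t ht => ?_
    rw [interior_Icc] at ht
    rw [(hφ t).deriv, ← inner_sub_left]
    have hle : ⟪gradient h (y + t • d) - gradient h y, d⟫ ≤ L * ‖t • d‖ * ‖d‖ :=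
      (real_inner_le_norm _ _).trans
        (mul_le_mul_of_nonneg_right (hlip (t • d)) (norm_nonneg d))
    rw [norm_smul, Real.norm_of_nonneg ht.1.le] at hle
    linarith
  have h01 := hanti (Set.left_mem_Icc.2 zero_le_one) (Set.right_mem_Icc.2 zero_le_one) zero_le_one
  simp only [φ, one_smul, zero_smul, add_zero] at h01
  linarith

/-- Optimality of a minimizer `d` of a convex composite quadratic model, tested against the
zero step. -/
theorem inner_add_inner_add_le_of_forall_le {F : Type*} [NormedAddCommGroup F]
    [InnerProductSpace ℝ F] {g : F → ℝ} (hg : ConvexOn ℝ Set.univ g) (Q : F →ₗ[ℝ] F) (v y d : F)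
    (hd : ∀ s, ⟪v, d⟫ + (1 / 2) * ⟪Q d, d⟫ + g (y + d) ≤
      ⟪v, s⟫ + (1 / 2) * ⟪Q s, s⟫ + g (y + s)) :
    ⟪v, d⟫ + ⟪Q d, d⟫ + g (y + d) ≤ g y := by
  have hstep : ∀ t ∈ Set.Ioo (0 : ℝ) 1,
      ⟪v, d⟫ + (1 - t / 2) * ⟪Q d, d⟫ + g (y + d) ≤ g y := by
    rintro t ⟨ht0, ht1⟩
    have hmin := hd ((1 - t) • d)
    have hconv := hg.2 (Set.mem_univ (y + d)) (Set.mem_univ y) (sub_nonneg.2 ht1.le) ht0.le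
      (sub_add_cancel 1 t)
    have hpoint : (1 - t) • (y + d) + t • y = y + (1 - t) • d := by module
    rw [hpoint, smul_eq_mul, smul_eq_mul] at hconv
    simp only [map_smul, real_inner_smul_left, real_inner_smul_right] at hmin
    refine le_of_mul_le_mul_left ?_ ht0
    linarith
  have hcont : Continuous fun t : ℝ => ⟪v, d⟫ + (1 - t / 2) * ⟪Q d, d⟫ + g (y + d) := by fun_prop
  have hlim := (hcont.tendsto 0).mono_left (nhdsWithin_le_nhds (s := Set.Ioi 0))
  simpa using le_of_tendsto hlim
    (Filter.eventually_of_mem (Ioo_mem_nhdsGT zero_lt_one) hstep)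

/-- Descent in the `Q`-weighted norm: if `d_i` minimizes `q_i(·; x)` then
`V(x +_i d_i) ≤ V(x) − (1/2)⟪Q d_i, d_i⟫`. -/
theorem stmt6 {N : ℕ} (hN : 1 ≤ N) {E : Fin N → Type*} [∀ i, NormedAddCommGroup (E i)]
    [∀ i, InnerProductSpace ℝ (E i)] [∀ i, FiniteDimensional ℝ (E i)]
    (f : (∀ i, E i) → ℝ) (hf : Differentiable ℝ f) (i : Fin N) (Li : ℝ) (hLi : 0 < Li)
    (hlip : ∀ (x : ∀ i, E i) (s : E i),
      ‖blockGrad f i (Function.update x i (x i + s)) - blockGrad f i x‖ ≤ Li * ‖s‖)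
    (g : ∀ j, E j → ℝ) (hg : ∀ j, ConvexOn ℝ Set.univ (g j))
    (Q : E i →ₗ[ℝ] E i) (hQsym : Q.IsSymmetric)
    (hQ : ∀ s : E i, Li * ‖s‖ ^ 2 ≤ ⟪Q s, s⟫)
    (x : ∀ i, E i) (di : E i)
    (hdi : ∀ s : E i, qApprox f i (g i) Q x di ≤ qApprox f i (g i) Q x s) :
    (f (Function.update x i (x i + di)) + ∑ j, g j (Function.update x i (x i + di) j)) ≤
      (f x + ∑ j, g j (x j)) - (1 / 2) * ⟪Q di, di⟫ := by
  have hdiff : Differentiable ℝ fun t => f (Function.update x i t) := fun t =>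
    (hf _).comp t (hasFDerivAt_update x t).differentiableAt
  have hdesc := descent_lemma (L := Li) (y := x i) hdiff
    (fun s => by simpa [blockGrad] using hlip x s) di
  have hopt := inner_add_inner_add_le_of_forall_le (hg i) Q (blockGrad f i x) (x i) di hdi
  rw [Function.update_eq_self] at hdesc
  have hsum : ∑ j, g j (Function.update x i (x i + di) j) =
      ∑ j, g j (x j) - g i (x i) + g i (x i + di) := by
    rw [← Finset.add_sum_erase _ _ (Finset.mem_univ i),
      ← Finset.add_sum_erase _ (fun j => g j (x j)) (Finset.mem_univ i),
      Finset.sum_congr rfl fun j hj => by rw [Function.update_of_ne (Finset.ne_of_mem_erase hj)],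
      Function.update_self]
    ring
  have hQd := hQ di
  unfold blockGrad at hopt
  rw [hsum]
  linarith
end

section
/- (Monotone decrease and convergence of the cost along the coordinate descent iterates.) Let f : X → ℝ be differentiable with block-i Lipschitz continuous gradient with constant L_i > 0 for every i, let g_1, …, g_N be convex real-valued functions on the respective blocks, and for each i let Q_i be a self-adjoint linear map on E_i with ⟪Q_i s, s⟫ ≥ L_i‖s‖² for all s ∈ E_i. Let (i_t)_{t ∈ ℕ} be any sequence in {1,…,N}, x(0) ∈ X, and define x(t+1) = x(t) +_{i_t} d_t where d_t minimizes s ↦ q_{i_t}(s; x(t)). Then the sequence V(x(t)) is nonincreasing; if moreover V is bounded below, then V(x(t)) converges to a finite limit. -/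
open scoped RealInnerProductSpace

/-- Descent lemma: a quadratic upper bound for a differentiable function whose gradient satisfies
a Lipschitz estimate at the base point. -/
theorem le_quadratic_of_gradient_lipschitz_at {F : Type*} [NormedAddCommGroup F]
    [InnerProductSpace ℝ F] [CompleteSpace F] {φ : F → ℝ} (hφ : Differentiable ℝ φ)
    {a : F} {K : ℝ} (hlip : ∀ s, ‖gradient φ (a + s) - gradient φ a‖ ≤ K * ‖s‖) (s : F) :
    φ (a + s) ≤ φ a + ⟪gradient φ a, s⟫ + K / 2 * ‖s‖ ^ 2 := by
  let h : ℝ → ℝ := fun τ => φ (a + τ • s) - τ * ⟪gradient φ a, s⟫ - K / 2 * ‖s‖ ^ 2 * τ ^ 2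
  have hder (τ : ℝ) : HasDerivAt h
      (⟪gradient φ (a + τ • s) - gradient φ a, s⟫ - K * τ * ‖s‖ ^ 2) τ := by
    have hline : HasDerivAt (fun τ : ℝ => a + τ • s) s τ := by
      simpa using ((hasDerivAt_id τ).smul_const s).const_add a
    have hcomp : HasDerivAt (fun τ : ℝ => φ (a + τ • s)) ⟪gradient φ (a + τ • s), s⟫ τ := by
      exact (hφ (a + τ • s)).hasGradientAt.hasFDerivAt.comp_hasDerivAt τ hline
    refine ((hcomp.sub ((hasDerivAt_id τ).mul_const ⟪gradient φ a, s⟫)).sub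
      ((hasDerivAt_pow 2 τ).const_mul (K / 2 * ‖s‖ ^ 2))).congr_deriv ?_
    rw [inner_sub_left]
    push_cast
    ring
  have hanti : AntitoneOn h (Set.Icc 0 1) := by
    refine antitoneOn_of_deriv_nonpos (convex_Icc 0 1)
      (fun τ _ => (hder τ).continuousAt.continuousWithinAt)
      (fun τ _ => (hder τ).differentiableAt.differentiableWithinAt) fun τ hτ => ?_
    rw [interior_Icc] at hτ
    have hbound := hlip (τ • s)
    rw [norm_smul, Real.norm_of_nonneg hτ.1.le] at hbound
    rw [(hder τ).deriv]
    have hinner := real_inner_le_norm (gradient φ (a + τ • s) - gradient φ a) s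
    have hmul := mul_le_mul_of_nonneg_right hbound (norm_nonneg s)
    nlinarith
  have hle := hanti (Set.left_mem_Icc.2 zero_le_one) (Set.right_mem_Icc.2 zero_le_one) zero_le_one
  simp only [h, one_smul, zero_smul, add_zero] at hle
  linarith

/-- Quadratic upper bound for `f` along a single block. -/
theorem update_le_quadratic_of_blockGrad_lipschitz {N : ℕ} {E : Fin N → Type*}
    [∀ i, NormedAddCommGroup (E i)] [∀ i, InnerProductSpace ℝ (E i)]
    [∀ i, FiniteDimensional ℝ (E i)] {f : (∀ i, E i) → ℝ} (hf : Differentiable ℝ f)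
    {i : Fin N} {K : ℝ} {x : ∀ i, E i}
    (hlip : ∀ s : E i,
      ‖blockGrad f i (Function.update x i (x i + s)) - blockGrad f i x‖ ≤ K * ‖s‖) (s : E i) :
    f (Function.update x i (x i + s)) ≤
      f x + ⟪blockGrad f i x, s⟫ + K / 2 * ‖s‖ ^ 2 := by
  have hφ : Differentiable ℝ (fun t => f (Function.update x i t)) :=
    hf.comp fun t => (hasFDerivAt_update x t).differentiableAt
  simp only [blockGrad, Function.update_idem, Function.update_self] at hlip
  simpa only [blockGrad, Function.update_eq_self] using
    le_quadratic_of_gradient_lipschitz_at hφ hlip s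

/-- Monotone decrease and convergence of the cost along the coordinate descent iterates. -/
theorem stmt10 {N : ℕ} (hN : 1 ≤ N) {E : Fin N → Type*} [∀ i, NormedAddCommGroup (E i)]
    [∀ i, InnerProductSpace ℝ (E i)] [∀ i, FiniteDimensional ℝ (E i)]
    (f : (∀ i, E i) → ℝ) (hf : Differentiable ℝ f)
    (L : Fin N → ℝ) (hL : ∀ i, 0 < L i)
    (hlip : ∀ i, ∀ (x : ∀ i, E i) (s : E i),
      ‖blockGrad f i (Function.update x i (x i + s)) - blockGrad f i x‖ ≤ L i * ‖s‖)
    (g : ∀ j, E j → ℝ) (hg : ∀ j, ConvexOn ℝ Set.univ (g j))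
    (Q : ∀ i, E i →ₗ[ℝ] E i) (hQsym : ∀ i, (Q i).IsSymmetric)
    (hQ : ∀ i, ∀ s : E i, L i * ‖s‖ ^ 2 ≤ ⟪(Q i) s, s⟫)
    (idx : ℕ → Fin N) (x : ℕ → ∀ i, E i) (d : (t : ℕ) → E (idx t))
    (hd : ∀ t, ∀ s : E (idx t),
      qApprox f (idx t) (g (idx t)) (Q (idx t)) (x t) (d t) ≤
        qApprox f (idx t) (g (idx t)) (Q (idx t)) (x t) s)
    (hx : ∀ t, x (t + 1) = Function.update (x t) (idx t) (x t (idx t) + d t)) :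
    Antitone (fun t => f (x t) + ∑ j, g j (x t j)) ∧
      ((∃ c : ℝ, ∀ y : ∀ i, E i, c ≤ f y + ∑ j, g j (y j)) →
        ∃ l : ℝ, Filter.Tendsto (fun t => f (x t) + ∑ j, g j (x t j))
          Filter.atTop (nhds l)) := by
  have hanti : Antitone (fun t => f (x t) + ∑ j, g j (x t j)) := by
    refine antitone_nat_of_succ_le fun t => ?_
    have hdesc := update_le_quadratic_of_blockGrad_lipschitz hf (hlip (idx t) (x t)) (d t)
    have hmin := hd t 0
    simp only [qApprox, inner_zero_right, map_zero, mul_zero, add_zero, zero_add] at hmin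
    have hcurv := hQ (idx t) (d t)
    have hsum : ∑ j, g j (x (t + 1) j) - ∑ j, g j (x t j) =
        g (idx t) (x t (idx t) + d t) - g (idx t) (x t (idx t)) := by
      rw [← Finset.sum_sub_distrib, Finset.sum_eq_single (idx t)]
      · rw [hx t, Function.update_self]
      · intro j _ hj
        rw [hx t, Function.update_of_ne hj, sub_self]
      · simp
    rw [← hx t] at hdesc
    linarith
  refine ⟨hanti, fun ⟨c, hc⟩ => ⟨_, tendsto_atTop_ciInf hanti ⟨c, ?_⟩⟩⟩
  rintro _ ⟨t, rfl⟩
  exact hc (x t)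
end

section
/- (Square-summability of the coordinate descent steps.) Under the setting of the coordinate descent iteration — f differentiable with block-i Lipschitz continuous gradients with constants L_i > 0, g_i convex real-valued, Q_i self-adjoint with ⟪Q_i s, s⟫ ≥ L_i‖s‖², x(t+1) = x(t) +_{i_t} d_t with d_t a minimizer of q_{i_t}(·; x(t)) — suppose V is bounded below by V_inf ∈ ℝ. Then Σ_{t=0}^{T-1} (L_{i_t}/2) ‖d_t‖² ≤ V(x(0)) − V_inf for every T, the series Σ_t ‖d_t‖² converges, and d_t → 0 as t → ∞. -/
open scoped RealInnerProductSpace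

open Set in
theorem image_add_le_of_lipschitz_gradient {F : Type*} [NormedAddCommGroup F]
    [InnerProductSpace ℝ F] [CompleteSpace F] {h : F → ℝ} (hh : Differentiable ℝ h) {K : ℝ}
    (a s : F) (hK : ∀ v, ‖gradient h (a + v) - gradient h a‖ ≤ K * ‖v‖) :
    h (a + s) ≤ h a + ⟪gradient h a, s⟫ + K / 2 * ‖s‖ ^ 2 := by
  let ψ : ℝ → ℝ := fun t => h (a + t • s) - t * ⟪gradient h a, s⟫ - K / 2 * ‖s‖ ^ 2 * t ^ 2
  have hψ (t : ℝ) : HasDerivAt ψ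
      (⟪gradient h (a + t • s), s⟫ - ⟪gradient h a, s⟫ - K / 2 * ‖s‖ ^ 2 * (2 * t)) t := by
    have hline : HasDerivAt (fun t : ℝ => a + t • s) s t := by
      simpa using ((hasDerivAt_id t).smul_const s).const_add a
    have hcomp := (hh (a + t • s)).hasGradientAt.hasFDerivAt.comp_hasDerivAt t hline
    have hlin := (hasDerivAt_id t).mul_const ⟪gradient h a, s⟫
    have hquad := ((hasDerivAt_id t).pow 2).const_mul (K / 2 * ‖s‖ ^ 2)
    exact ((hcomp.sub hlin).sub hquad).congr_deriv (by simp)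
  have hanti : AntitoneOn ψ (Icc 0 1) := by
    refine antitoneOn_of_deriv_nonpos (convex_Icc 0 1)
      (fun t _ => (hψ t).continuousAt.continuousWithinAt)
      (fun t _ => (hψ t).differentiableAt.differentiableWithinAt) fun t ht => ?_
    rw [interior_Icc] at ht
    rw [(hψ t).deriv, ← inner_sub_left]
    have hcs := real_inner_le_norm (gradient h (a + t • s) - gradient h a) s
    have hlip := mul_le_mul_of_nonneg_right (hK (t • s)) (norm_nonneg s)
    rw [norm_smul, Real.norm_of_nonneg ht.1.le] at hlip
    linarith
  have hle := hanti (left_mem_Icc.2 zero_le_one) (right_mem_Icc.2 zero_le_one) zero_le_one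
  simp only [ψ, one_smul, zero_smul, add_zero] at hle
  linarith

theorem inner_add_inner_add_le_of_minimizer {F : Type*} [NormedAddCommGroup F]
    [InnerProductSpace ℝ F] {g : F → ℝ} (hg : ConvexOn ℝ Set.univ g) {Q : F →ₗ[ℝ] F} {c a d : F}
    (hQ : 0 ≤ ⟪Q d, d⟫)
    (hd : ∀ s, ⟪c, d⟫ + 1 / 2 * ⟪Q d, d⟫ + g (a + d) ≤ ⟪c, s⟫ + 1 / 2 * ⟪Q s, s⟫ + g (a + s)) :
    ⟪c, d⟫ + ⟪Q d, d⟫ + g (a + d) ≤ g a := by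
  have key (ε : ℝ) (h0 : 0 < ε) (h1 : ε ≤ 1) :
      ⟪c, d⟫ + ⟪Q d, d⟫ + g (a + d) - g a ≤ ε * ⟪Q d, d⟫ / 2 := by
    have hmin := hd ((1 - ε) • d)
    have hconv := hg.2 (Set.mem_univ a) (Set.mem_univ (a + d)) h0.le (sub_nonneg.2 h1)
      (add_sub_cancel ε 1)
    have hpt : ε • a + (1 - ε) • (a + d) = a + (1 - ε) • d := by module
    rw [hpt] at hconv
    simp only [map_smul, inner_smul_left, inner_smul_right, smul_eq_mul, conj_trivial]
      at hmin hconv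
    refine le_of_mul_le_mul_left ?_ h0
    linarith
  by_contra! hlt
  set r := ⟪c, d⟫ + ⟪Q d, d⟫ + g (a + d) - g a with hr
  have hrpos : 0 < r := by linarith
  have hsum : 0 < r + ⟪Q d, d⟫ := by linarith
  have hle := key (r / (r + ⟪Q d, d⟫)) (by positivity) ((div_le_one hsum).2 (by linarith))
  have hfrac : ⟪Q d, d⟫ / (r + ⟪Q d, d⟫) ≤ 1 := (div_le_one hsum).2 (by linarith)
  have hmul := mul_le_mul_of_nonneg_left hfrac hrpos.le
  have hcomm : r / (r + ⟪Q d, d⟫) * ⟪Q d, d⟫ = r * (⟪Q d, d⟫ / (r + ⟪Q d, d⟫)) := by ring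
  linarith

theorem sum_update_apply_sub {ι : Type*} [Fintype ι] [DecidableEq ι] {E : ι → Type*}
    (g : ∀ j, E j → ℝ) (x : ∀ i, E i) (i : ι) (y : E i) :
    ∑ j, g j (Function.update x i y j) - ∑ j, g j (x j) = g i y - g i (x i) := by
  rw [← Finset.sum_sub_distrib, Finset.sum_eq_single i]
  · simp
  · intro j _ hj
    simp [Function.update_of_ne hj]
  · simp

section BlockDescent

variable {N : ℕ} {E : Fin N → Type*} [∀ i, NormedAddCommGroup (E i)]
  [∀ i, InnerProductSpace ℝ (E i)] [∀ i, FiniteDimensional ℝ (E i)]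

theorem image_update_add_le {f : (∀ i, E i) → ℝ} (hf : Differentiable ℝ f) {i : Fin N} {K : ℝ}
    (x : ∀ i, E i)
    (hK : ∀ s : E i,
      ‖blockGrad f i (Function.update x i (x i + s)) - blockGrad f i x‖ ≤ K * ‖s‖) (s : E i) :
    f (Function.update x i (x i + s)) ≤ f x + ⟪blockGrad f i x, s⟫ + K / 2 * ‖s‖ ^ 2 := by
  have hh : Differentiable ℝ fun t => f (Function.update x i t) :=
    hf.comp fun t => (hasFDerivAt_update x t).differentiableAt
  have := image_add_le_of_lipschitz_gradient hh (x i) s fun v => by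
    simpa [blockGrad] using hK v
  simpa [blockGrad] using this

theorem composite_cost_update_le {f : (∀ i, E i) → ℝ} (hf : Differentiable ℝ f) {i : Fin N}
    {K : ℝ} (hK0 : 0 ≤ K) {x : ∀ i, E i}
    (hK : ∀ s : E i,
      ‖blockGrad f i (Function.update x i (x i + s)) - blockGrad f i x‖ ≤ K * ‖s‖)
    (g : ∀ j, E j → ℝ) (hg : ConvexOn ℝ Set.univ (g i)) {Q : E i →ₗ[ℝ] E i} {d : E i}
    (hQ : K * ‖d‖ ^ 2 ≤ ⟪Q d, d⟫)
    (hd : ∀ s, qApprox f i (g i) Q x d ≤ qApprox f i (g i) Q x s) :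
    f (Function.update x i (x i + d)) + ∑ j, g j (Function.update x i (x i + d) j) +
      K / 2 * ‖d‖ ^ 2 ≤ f x + ∑ j, g j (x j) := by
  have hdesc := image_update_add_le hf x hK d
  have hopt := inner_add_inner_add_le_of_minimizer hg (le_trans (by positivity) hQ) hd
  have hsum := sum_update_apply_sub g x i (x i + d)
  linarith

end BlockDescent

/-- Square-summability of the coordinate descent steps: if `V` is bounded below by `Vinf`,
then `Σ_{t<T} (L_{i_t}/2)‖d_t‖² ≤ V(x(0)) − Vinf`, the series `Σ_t ‖d_t‖²` converges,
and `d_t → 0`. -/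
theorem stmt11 {N : ℕ} (hN : 1 ≤ N) {E : Fin N → Type*} [∀ i, NormedAddCommGroup (E i)]
    [∀ i, InnerProductSpace ℝ (E i)] [∀ i, FiniteDimensional ℝ (E i)]
    (f : (∀ i, E i) → ℝ) (hf : Differentiable ℝ f)
    (L : Fin N → ℝ) (hL : ∀ i, 0 < L i)
    (hlip : ∀ i, ∀ (x : ∀ i, E i) (s : E i),
      ‖blockGrad f i (Function.update x i (x i + s)) - blockGrad f i x‖ ≤ L i * ‖s‖)
    (g : ∀ j, E j → ℝ) (hg : ∀ j, ConvexOn ℝ Set.univ (g j))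
    (Q : ∀ i, E i →ₗ[ℝ] E i) (hQsym : ∀ i, (Q i).IsSymmetric)
    (hQ : ∀ i, ∀ s : E i, L i * ‖s‖ ^ 2 ≤ ⟪(Q i) s, s⟫)
    (idx : ℕ → Fin N) (x : ℕ → ∀ i, E i) (d : (t : ℕ) → E (idx t))
    (hd : ∀ t, ∀ s : E (idx t),
      qApprox f (idx t) (g (idx t)) (Q (idx t)) (x t) (d t) ≤
        qApprox f (idx t) (g (idx t)) (Q (idx t)) (x t) s)
    (hx : ∀ t, x (t + 1) = Function.update (x t) (idx t) (x t (idx t) + d t))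
    (Vinf : ℝ) (hVinf : ∀ y : ∀ i, E i, Vinf ≤ f y + ∑ j, g j (y j)) :
    (∀ T : ℕ, ∑ t ∈ Finset.range T, L (idx t) / 2 * ‖d t‖ ^ 2 ≤
        (f (x 0) + ∑ j, g j (x 0 j)) - Vinf) ∧
      Summable (fun t => ‖d t‖ ^ 2) ∧
      Filter.Tendsto (fun t => ‖d t‖) Filter.atTop (nhds 0) := by
  have hstep (t : ℕ) : f (x (t + 1)) + ∑ j, g j (x (t + 1) j) + L (idx t) / 2 * ‖d t‖ ^ 2 ≤
      f (x t) + ∑ j, g j (x t j) := by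
    rw [hx t]
    exact composite_cost_update_le hf (hL _).le (hlip _ _) g (hg _) (hQ _ _) (hd t)
  have hbound (T : ℕ) : ∑ t ∈ Finset.range T, L (idx t) / 2 * ‖d t‖ ^ 2 ≤
      (f (x 0) + ∑ j, g j (x 0 j)) - Vinf := by
    have htel : ∑ t ∈ Finset.range T, L (idx t) / 2 * ‖d t‖ ^ 2 ≤
        (f (x 0) + ∑ j, g j (x 0 j)) - (f (x T) + ∑ j, g j (x T j)) := by
      rw [← Finset.sum_range_sub' (fun t => f (x t) + ∑ j, g j (x t j))]
      exact Finset.sum_le_sum fun t _ => by linarith [hstep t]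
    linarith [hVinf (x T)]
  have hsummable : Summable fun t => ‖d t‖ ^ 2 := by
    have : Nonempty (Fin N) := ⟨idx 0⟩
    obtain ⟨m, hm⟩ := Finite.exists_min L
    have hweighted : Summable fun t => L (idx t) / 2 * ‖d t‖ ^ 2 :=
      summable_of_sum_range_le
        (fun t => mul_nonneg (half_pos (hL _)).le (sq_nonneg _)) hbound
    refine (summable_mul_left_iff (half_pos (hL m)).ne').1 ?_
    refine hweighted.of_nonneg_of_le
      (fun t => mul_nonneg (half_pos (hL _)).le (sq_nonneg _)) fun t => ?_
    gcongr
    exact hm _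
  refine ⟨hbound, hsummable, ?_⟩
  simpa [Real.sqrt_sq] using hsummable.tendsto_atTop_zero.sqrt
end

section
/- (Stationarity of the limit of the coordinate descent iterates.) Let f : X → ℝ be continuously differentiable with block-i Lipschitz continuous gradient with constant L_i > 0 for every i, let g_1, …, g_N be convex continuous real-valued functions on the respective blocks, and for each i let Q_i be a self-adjoint linear map on E_i with ⟪Q_i s, s⟫ ≥ L_i‖s‖² for all s ∈ E_i. Let (i_t) be a sequence in {1,…,N} in which every index i ∈ {1,…,N} occurs infinitely often, and let x(t+1) = x(t) +_{i_t} d_t with d_t a minimizer of q_{i_t}(·; x(t)). Suppose V is bounded below and x(t) converges to some x* ∈ X. Then x* is a stationary point of V: for every i ∈ {1,…,N}, the vector −∇_i f(x*) is a subgradient of g_i at x*_i, i.e. g_i(y) ≥ g_i(x*_i) − ⟪∇_i f(x*), y − x*_i⟫ for all y ∈ E_i. -/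
open scoped RealInnerProductSpace

theorem continuous_blockGrad {N : ℕ} {E : Fin N → Type*} [∀ i, NormedAddCommGroup (E i)]
    [∀ i, InnerProductSpace ℝ (E i)] [∀ i, FiniteDimensional ℝ (E i)]
    {f : (∀ i, E i) → ℝ} (hf : ContDiff ℝ 1 f) (i : Fin N) :
    Continuous (blockGrad f i) := by
  have h : ∀ x, fderiv ℝ (fun t => f (Function.update x i t)) (x i) =
      (fderiv ℝ f x).comp (.pi (Pi.single i (.id ℝ (E i)))) := fun x => by
    have hfx : HasFDerivAt f (fderiv ℝ f x) (Function.update x i (x i)) := by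
      simpa using (hf.differentiable one_ne_zero x).hasFDerivAt
    exact (hfx.comp (x i) (hasFDerivAt_update x (x i))).fderiv
  unfold blockGrad gradient
  simp only [h]
  exact (LinearIsometryEquiv.continuous _).comp
    ((hf.continuous_fderiv one_ne_zero).clm_comp continuous_const)

theorem continuous_qApprox {N : ℕ} {E : Fin N → Type*} [∀ i, NormedAddCommGroup (E i)]
    [∀ i, InnerProductSpace ℝ (E i)] [∀ i, FiniteDimensional ℝ (E i)]
    {f : (∀ i, E i) → ℝ} (hf : ContDiff ℝ 1 f) (i : Fin N) {g : E i → ℝ} (hg : Continuous g)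
    (Q : E i →ₗ[ℝ] E i) :
    Continuous fun p : (∀ i, E i) × E i => qApprox f i g Q p.1 p.2 := by
  have hG := continuous_blockGrad hf i
  have hQ : Continuous Q := Q.continuous_of_finiteDimensional
  unfold qApprox
  fun_prop

/-- If `s = 0` minimizes the convex model `⟪v, s⟫ + (1/2)⟪Q s, s⟫ + g (z + s)`, then `-v` is a
subgradient of `g` at `z`. -/
theorem ConvexOn.sub_inner_le_of_quadratic_model {F : Type*} [NormedAddCommGroup F]
    [InnerProductSpace ℝ F] {g : F → ℝ} (hg : ConvexOn ℝ Set.univ g) (Q : F →ₗ[ℝ] F) (v z : F)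
    (hmin : ∀ s, g z ≤ ⟪v, s⟫ + (1 / 2) * ⟪Q s, s⟫ + g (z + s)) (y : F) :
    g z - ⟪v, y - z⟫ ≤ g y := by
  have hseg : ∀ r ∈ Set.Ioo (0 : ℝ) 1,
      0 ≤ ⟪v, y - z⟫ + r * ((1 / 2) * ⟪Q (y - z), y - z⟫) + (g y - g z) := by
    rintro r ⟨hr0, hr1⟩
    have hm := hmin (r • (y - z))
    have hc := hg.2 (Set.mem_univ z) (Set.mem_univ y) (sub_nonneg.2 hr1.le) hr0.le
      (sub_add_cancel 1 r)
    rw [show (1 - r) • z + r • y = z + r • (y - z) by module] at hc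
    simp only [map_smul, real_inner_smul_left, real_inner_smul_right, smul_eq_mul] at hm hc
    refine nonneg_of_mul_nonneg_right (a := r) ?_ hr0
    linarith
  have hlim : Filter.Tendsto
      (fun r : ℝ => ⟪v, y - z⟫ + r * ((1 / 2) * ⟪Q (y - z), y - z⟫) + (g y - g z))
      (nhdsWithin 0 (Set.Ioi 0)) (nhds (⟪v, y - z⟫ + (g y - g z))) := by
    refine Filter.Tendsto.mono_left (Continuous.tendsto' ?_ _ _ ?_) nhdsWithin_le_nhds
    · fun_prop
    · simp
  have := ge_of_tendsto hlim
    (Filter.eventually_of_mem (Ioo_mem_nhdsGT one_pos) hseg)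
  linarith

/-- Stationarity of the limit: if every block index occurs infinitely often and the
iterates converge to `x*`, then `x*` is a stationary point of `V`: for every `i`,
`−∇_i f(x*)` is a subgradient of `g_i` at `x*_i`. -/
theorem stmt12 {N : ℕ} (hN : 1 ≤ N) {E : Fin N → Type*} [∀ i, NormedAddCommGroup (E i)]
    [∀ i, InnerProductSpace ℝ (E i)] [∀ i, FiniteDimensional ℝ (E i)]
    (f : (∀ i, E i) → ℝ) (hf : ContDiff ℝ 1 f)
    (L : Fin N → ℝ) (hL : ∀ i, 0 < L i)
    (hlip : ∀ i, ∀ (x : ∀ i, E i) (s : E i),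
      ‖blockGrad f i (Function.update x i (x i + s)) - blockGrad f i x‖ ≤ L i * ‖s‖)
    (g : ∀ j, E j → ℝ) (hg : ∀ j, ConvexOn ℝ Set.univ (g j))
    (hgc : ∀ j, Continuous (g j))
    (Q : ∀ i, E i →ₗ[ℝ] E i) (hQsym : ∀ i, (Q i).IsSymmetric)
    (hQ : ∀ i, ∀ s : E i, L i * ‖s‖ ^ 2 ≤ ⟪(Q i) s, s⟫)
    (idx : ℕ → Fin N) (hidx : ∀ i : Fin N, ∀ T : ℕ, ∃ t, T ≤ t ∧ idx t = i)
    (x : ℕ → ∀ i, E i) (d : (t : ℕ) → E (idx t))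
    (hd : ∀ t, ∀ s : E (idx t),
      qApprox f (idx t) (g (idx t)) (Q (idx t)) (x t) (d t) ≤
        qApprox f (idx t) (g (idx t)) (Q (idx t)) (x t) s)
    (hx : ∀ t, x (t + 1) = Function.update (x t) (idx t) (x t (idx t) + d t))
    (hbdd : ∃ c : ℝ, ∀ y : ∀ i, E i, c ≤ f y + ∑ j, g j (y j))
    (xstar : ∀ i, E i) (hconv : Filter.Tendsto x Filter.atTop (nhds xstar)) :
    ∀ i : Fin N, ∀ y : E i,
      g i (xstar i) - ⟪blockGrad f i xstar, y - xstar i⟫ ≤ g i y := by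
  intro i
  have hstep : ∀ t, idx t = i → ∀ s, qApprox f i (g i) (Q i) (x t) (x (t + 1) i - x t i) ≤
      qApprox f i (g i) (Q i) (x t) s := by
    rintro t rfl s
    simpa [hx t] using hd t s
  have hfreq : ∃ᶠ t in Filter.atTop, idx t = i :=
    Filter.frequently_atTop.2 (hidx i)
  have hxi : Filter.Tendsto (fun t => x t i) Filter.atTop (nhds (xstar i)) :=
    tendsto_pi_nhds.1 hconv i
  have hdiff : Filter.Tendsto (fun t => x (t + 1) i - x t i) Filter.atTop (nhds 0) := by
    simpa using (hxi.comp (Filter.tendsto_add_atTop_nat 1)).sub hxi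
  have hq := continuous_qApprox hf i (hgc i) (Q i)
  refine (hg i).sub_inner_le_of_quadratic_model (Q i) _ _ fun s => ?_
  have hlim := le_of_tendsto_of_tendsto_of_frequently
    ((hq.tendsto (xstar, 0)).comp (hconv.prodMk_nhds hdiff))
    ((hq.tendsto (xstar, s)).comp (hconv.prodMk_nhds tendsto_const_nhds))
    (hfreq.mono fun t ht => hstep t ht s)
  simpa [qApprox] using hlim
end

section
/- (Convergence of the cost for the randomized coordinate descent / distributed algorithm.) Let f : X → ℝ be differentiable with block-i Lipschitz continuous gradient with constant L_i > 0 for every i, let g_1, …, g_N be convex real-valued functions on the respective blocks, let Q_i be self-adjoint on E_i with ⟪Q_i s, s⟫ ≥ L_i‖s‖² for all s ∈ E_i, and suppose V is bounded below. Let (Ω, ℱ, P) be a probability space, let (i_t)_{t ∈ ℕ} : Ω → {1,…,N} be any sequence of random block indices, and define the random sequence x(t) by x(0) ≡ x_0 ∈ X and x(t+1) = x(t) +_{i_t} d_t, where d_t is the unique minimizer of s ↦ q_{i_t}(s; x(t)). Then almost surely (indeed, for every ω ∈ Ω) the sequence V(x(t)) converges: P( V(x(t)) converges to some finite limit ) =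 1. -/
open scoped RealInnerProductSpace

open MeasureTheory
open scoped ProbabilityTheory

/-- The restriction of `f` to the `i`-th block through `x` has gradient `blockGrad f i` at the
point `y`. -/
theorem hasGradientAt_comp_update {N : ℕ} {E : Fin N → Type*} [∀ i, NormedAddCommGroup (E i)]
    [∀ i, InnerProductSpace ℝ (E i)] [∀ i, FiniteDimensional ℝ (E i)]
    {f : (∀ i, E i) → ℝ} (hf : Differentiable ℝ f) (i : Fin N) (x : ∀ i, E i) (y : E i) :
    HasGradientAt (fun t => f (Function.update x i t))
      (blockGrad f i (Function.update x i y)) y := by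
  have hdiff : DifferentiableAt ℝ (fun t => f (Function.update x i t)) y :=
    (hf _).comp y (hasFDerivAt_update x y).differentiableAt
  simpa [blockGrad] using hdiff.hasGradientAt

/-- The descent lemma along a single block. -/
theorem blockwise_descent {N : ℕ} {E : Fin N → Type*} [∀ i, NormedAddCommGroup (E i)]
    [∀ i, InnerProductSpace ℝ (E i)] [∀ i, FiniteDimensional ℝ (E i)]
    {f : (∀ i, E i) → ℝ} (hf : Differentiable ℝ f) (i : Fin N) (L : ℝ) (x : ∀ i, E i)
    (hlip : ∀ s : E i,
      ‖blockGrad f i (Function.update x i (x i + s)) - blockGrad f i x‖ ≤ L * ‖s‖) (s : E i) :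
    f (Function.update x i (x i + s)) ≤ f x + ⟪blockGrad f i x, s⟫ + L / 2 * ‖s‖ ^ 2 := by
  set φ : ℝ → ℝ := fun t => f (Function.update x i (x i + t • s)) - t * ⟪blockGrad f i x, s⟫
    - t ^ 2 * (L / 2 * ‖s‖ ^ 2) with hφ
  have hderiv (t : ℝ) : HasDerivAt φ
      (⟪blockGrad f i (Function.update x i (x i + t • s)), s⟫ - ⟪blockGrad f i x, s⟫
        - 2 * t * (L / 2 * ‖s‖ ^ 2)) t := by
    have hline : HasDerivAt (fun t : ℝ => x i + t • s) s t := by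
      simpa using ((hasDerivAt_id t).smul_const s).const_add (x i)
    have hf' := (hasGradientAt_comp_update hf i x (x i + t • s)).hasFDerivAt.comp_hasDerivAt t hline
    have hlin := (hasDerivAt_id t).mul_const ⟪blockGrad f i x, s⟫
    have hsq := ((hasDerivAt_id t).pow 2).mul_const (L / 2 * ‖s‖ ^ 2)
    refine ((hf'.sub hlin).sub hsq).congr_deriv ?_
    simp
  have hanti : AntitoneOn φ (Set.Icc 0 1) := by
    refine antitoneOn_of_deriv_nonpos (convex_Icc 0 1)
      (fun t _ => (hderiv t).continuousAt.continuousWithinAt)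
      (fun t _ => (hderiv t).differentiableAt.differentiableWithinAt) fun t ht => ?_
    rw [interior_Icc] at ht
    rw [(hderiv t).deriv, ← inner_sub_left]
    have hcs := real_inner_le_norm
      (blockGrad f i (Function.update x i (x i + t • s)) - blockGrad f i x) s
    have hmul := mul_le_mul_of_nonneg_right (hlip (t • s)) (norm_nonneg s)
    rw [norm_smul, Real.norm_of_nonneg ht.1.le] at hmul
    linarith
  have h := hanti (Set.left_mem_Icc.2 zero_le_one) (Set.right_mem_Icc.2 zero_le_one) zero_le_one
  simp only [hφ, one_smul, zero_smul, add_zero, Function.update_eq_self] at h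
  linarith

/-- A block update that does not increase the local model does not increase the cost. -/
theorem cost_update_le {N : ℕ} {E : Fin N → Type*} [∀ i, NormedAddCommGroup (E i)]
    [∀ i, InnerProductSpace ℝ (E i)] [∀ i, FiniteDimensional ℝ (E i)]
    {f : (∀ i, E i) → ℝ} (hf : Differentiable ℝ f) (i : Fin N) (L : ℝ) (x : ∀ i, E i)
    (hlip : ∀ s : E i,
      ‖blockGrad f i (Function.update x i (x i + s)) - blockGrad f i x‖ ≤ L * ‖s‖)
    (g : ∀ j, E j → ℝ) (Q : E i →ₗ[ℝ] E i) (s : E i) (hQ : L * ‖s‖ ^ 2 ≤ ⟪Q s, s⟫)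
    (hs : qApprox f i (g i) Q x s ≤ qApprox f i (g i) Q x 0) :
    f (Function.update x i (x i + s)) + ∑ j, g j (Function.update x i (x i + s) j) ≤
      f x + ∑ j, g j (x j) := by
  have hdesc := blockwise_descent hf i L x hlip s
  simp only [qApprox, inner_zero_right, add_zero, mul_zero, zero_add] at hs
  have hsum : ∑ j ∈ Finset.univ.erase i, g j (Function.update x i (x i + s) j) =
      ∑ j ∈ Finset.univ.erase i, g j (x j) :=
    Finset.sum_congr rfl fun j hj => by rw [Function.update_of_ne (Finset.ne_of_mem_erase hj)]
  rw [← Finset.add_sum_erase _ _ (Finset.mem_univ i),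
    ← Finset.add_sum_erase _ (fun j => g j (x j)) (Finset.mem_univ i), hsum,
    Function.update_self]
  linarith

/-- Convergence of the cost for the randomized coordinate descent distributed algorithm:
the random sequence `V(x(t))` converges almost surely. -/
theorem stmt15 {N : ℕ} (hN : 1 ≤ N) {E : Fin N → Type*} [∀ i, NormedAddCommGroup (E i)]
    [∀ i, InnerProductSpace ℝ (E i)] [∀ i, FiniteDimensional ℝ (E i)]
    (f : (∀ i, E i) → ℝ) (hf : Differentiable ℝ f)
    (L : Fin N → ℝ) (hL : ∀ i, 0 < L i)
    (hlip : ∀ i, ∀ (x : ∀ i, E i) (s : E i),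
      ‖blockGrad f i (Function.update x i (x i + s)) - blockGrad f i x‖ ≤ L i * ‖s‖)
    (g : ∀ j, E j → ℝ) (hg : ∀ j, ConvexOn ℝ Set.univ (g j))
    (Q : ∀ i, E i →ₗ[ℝ] E i) (hQsym : ∀ i, (Q i).IsSymmetric)
    (hQ : ∀ i, ∀ s : E i, L i * ‖s‖ ^ 2 ≤ ⟪(Q i) s, s⟫)
    (hbdd : ∃ c : ℝ, ∀ y : ∀ i, E i, c ≤ f y + ∑ j, g j (y j))
    (Ω : Type*) [MeasureSpace Ω] [IsProbabilityMeasure (ℙ : Measure Ω)]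
    (idx : ℕ → Ω → Fin N) (x0 : ∀ i, E i) (x : ℕ → Ω → ∀ i, E i)
    (d : (t : ℕ) → (ω : Ω) → E (idx t ω))
    (hd : ∀ t ω, ∀ s : E (idx t ω),
      qApprox f (idx t ω) (g (idx t ω)) (Q (idx t ω)) (x t ω) (d t ω) ≤
        qApprox f (idx t ω) (g (idx t ω)) (Q (idx t ω)) (x t ω) s)
    (hx0 : ∀ ω, x 0 ω = x0)
    (hx : ∀ t ω, x (t + 1) ω =
      Function.update (x t ω) (idx t ω) (x t ω (idx t ω) + d t ω)) :
    ℙ {ω : Ω | ∃ l : ℝ, Filter.Tendsto (fun t => f (x t ω) + ∑ j, g j (x t ω j))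
      Filter.atTop (nhds l)} = 1 := by
  obtain ⟨c, hc⟩ := hbdd
  have hconv : ∀ ω, ∃ l : ℝ, Filter.Tendsto (fun t => f (x t ω) + ∑ j, g j (x t ω j))
      Filter.atTop (nhds l) := fun ω => by
    have hanti : Antitone fun t => f (x t ω) + ∑ j, g j (x t ω j) :=
      antitone_nat_of_succ_le fun t => by
        rw [hx t ω]
        exact cost_update_le hf _ _ _ (hlip _ _) g _ _ (hQ _ _) (hd t ω 0)
    exact ⟨_, tendsto_atTop_ciInf hanti ⟨c, Set.forall_mem_range.2 fun t => hc (x t ω)⟩⟩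
  simp [hconv]
end
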